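/- Let n ≥ 3 be an odd integer and p a prime such that p > n or p = 2. Then for every integer r ≥ 2 one has V_n(p^r) = p^{n−2}·V_n(p^{r−1}) and S_n(p^r) = 0. -/

import Mathlib

open Finset

/-- The Kloosterman sum `K(u,v;q) = ∑_{x ∈ (ℤ/qℤ)^*} e^{2πi(ux + v x̄)/q}`. -/
noncomputable def Kl (q : ℕ) (u v : ℤ) : ℂ :=
  ∑ x ∈ Finset.range q,
    if Nat.Coprime x q then
      Complex.exp (2 * Real.pi * Complex.I *
        ((u : ℂ) * (x : ℂ) + (v : ℂ) * ((((x : ZMod q)⁻¹ : ZMod q).val : ℕ) : ℂ)) / (q : ℂ))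
    else 0

/-- The `n`-th power moment `S_n(q) = ∑_{u=1}^q K(u,1;q)^n`. -/
noncomputable def S (n q : ℕ) : ℂ :=
  ∑ u ∈ Finset.range q, Kl q ((u : ℤ) + 1) 1 ^ n

/-- `V_n(q)`: number of tuples `(x_1,…,x_{n-1})` of units mod `q` with
`(x_1+⋯+x_{n-1})·(x_1⁻¹+⋯+x_{n-1}⁻¹) ≡ 1 (mod q)`. -/
noncomputable def V (n q : ℕ) : ℕ :=
  Nat.card {x : Fin (n - 1) → (ZMod q)ˣ //
    (∑ i, ((x i : ZMod q))) * (∑ i, (((x i)⁻¹ : (ZMod q)ˣ) : ZMod q)) = 1}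

theorem sum_ne_zero_of_sq_eq_sq {p : ℕ} [Fact p.Prime] {ι : Type*} [Fintype ι]
    (hodd : Odd (Fintype.card ι)) (hcase : Fintype.card ι < p ∨ p = 2)
    (x : ι → ZMod p) {a : ZMod p} (ha : a ≠ 0) (hx : ∀ i, x i ^ 2 = a ^ 2) :
    ∑ i, x i ≠ 0 := by
  have hsign : ∀ i, ∃ e : ℤ, (e = 1 ∨ e = -1) ∧ x i = e * a := fun i ↦ by
    rcases sq_eq_sq_iff_eq_or_eq_neg.mp (hx i) with h | h
    · exact ⟨1, Or.inl rfl, by simp [h]⟩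
    · exact ⟨-1, Or.inr rfl, by simp [h]⟩
  choose e he hxe using hsign
  have hsum_odd : Odd (∑ i, e i) := by
    have heven : Even (∑ i, (e i - 1)) := Finset.even_sum _ fun i _ ↦ by
      rcases he i with h | h <;> rw [h] <;> decide
    have hsplit : ∑ i, e i = ∑ i, (e i - 1) + Fintype.card ι := by simp
    rw [hsplit]
    exact heven.add_odd (by exact_mod_cast hodd)
  have hsum_abs : |∑ i, e i| ≤ Fintype.card ι := by
    refine (Finset.abs_sum_le_sum_abs _ _).trans ?_
    have : ∀ i, |e i| = 1 := fun i ↦ by rcases he i with h | h <;> rw [h] <;> simp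
    simp [this]
  intro h0
  have hmul : ((∑ i, e i : ℤ) : ZMod p) * a = 0 := by
    rw [← h0, Int.cast_sum, Finset.sum_mul]
    exact Finset.sum_congr rfl fun i _ ↦ (hxe i).symm
  have hdvd : (p : ℤ) ∣ ∑ i, e i :=
    (ZMod.intCast_zmod_eq_zero_iff_dvd _ _).mp ((mul_eq_zero.mp hmul).resolve_right ha)
  rcases hcase with hlt | rfl
  · have := Int.eq_zero_of_abs_lt_dvd hdvd (hsum_abs.trans_lt (by exact_mod_cast hlt))
    rw [this] at hsum_odd
    exact absurd hsum_odd (by decide)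
  · exact (Int.not_even_iff_odd.mpr hsum_odd) (even_iff_two_dvd.mpr (by exact_mod_cast hdvd))

@[to_additive]
theorem MonoidHom.card_subtype_comp_mul_card {G H : Type*} [Group G] [Group H] [Finite G]
    [Finite H] (f : G →* H) (hf : Function.Surjective f) (P : H → Prop) :
    Nat.card {g // P (f g)} * Nat.card H = Nat.card G * Nat.card {h // P h} := by
  classical
  have := Fintype.ofFinite G
  have := Fintype.ofFinite H
  have hfiber : ∀ h, #{g | f g = h} = #{g | f g = 1} := fun h ↦
    MonoidHom.card_fiber_eq_of_mem_range f (hf h) (hf 1)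
  have hP : #{g | P (f g)} = #{h | P h} * #{g | f g = 1} := by
    rw [Finset.card_eq_sum_card_fiberwise (f := f) (t := {h | P h})
      (fun g hg ↦ by simpa using hg), Finset.sum_const_nat]
    intro h hh
    rw [← hfiber h, Finset.filter_filter]
    congr 1
    ext g
    simp only [Finset.mem_filter, Finset.mem_univ, true_and] at hh ⊢
    exact ⟨And.right, fun hg ↦ ⟨hg ▸ hh, hg⟩⟩
  have hG : Fintype.card G = Fintype.card H * #{g | f g = 1} := by
    rw [← Finset.card_univ, Finset.card_eq_sum_card_fiberwise (f := f) (t := Finset.univ)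
      (fun g _ ↦ by simp), Finset.sum_const_nat fun h _ ↦ hfiber h, Finset.card_univ]
  simp only [Nat.card_eq_fintype_card, Fintype.card_subtype]
  rw [hP, hG]
  ring

theorem AddChar.map_sum_eq_prod {A M ι : Type*} [AddCommMonoid A] [CommMonoid M]
    (ψ : AddChar A M) (s : Finset ι) (f : ι → A) : ψ (∑ i ∈ s, f i) = ∏ i ∈ s, ψ (f i) := by
  classical
  induction s using Finset.induction_on with
  | empty => simp
  | insert i s hi ih => rw [Finset.sum_insert hi, Finset.prod_insert hi, ψ.map_add_eq_mul, ih]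

/-- The unit `1 + ε * y` attached to an element `ε` of square zero. -/
def unitOneAdd {R : Type*} [CommRing R] {ε : R} (hε : ε * ε = 0) (y : R) : Rˣ where
  val := 1 + ε * y
  inv := 1 - ε * y
  val_inv := by linear_combination (-y ^ 2) * hε
  inv_val := by linear_combination (-y ^ 2) * hε

section FiniteRing

variable {R : Type*} [CommRing R] [Fintype R] [DecidableEq R] {ε : R} {ψ : AddChar R ℂ}

/-- Only the `x` with `ε * (u * x - x⁻¹) = 0` contribute to a Kloosterman sum. -/
theorem sum_units_eq_sum_ite (hψ : ψ.IsPrimitive) (hε : ε * ε = 0) (u : R) :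
    ∑ x : Rˣ, ψ (u * x + (x⁻¹ : Rˣ)) =
      ∑ x : Rˣ, if ε * (u * x - (x⁻¹ : Rˣ)) = 0 then ψ (u * x + (x⁻¹ : Rˣ)) else 0 := by
  have hcard : (Fintype.card R : ℂ) ≠ 0 := by simp
  refine mul_left_cancel₀ hcard ?_
  calc (Fintype.card R : ℂ) * ∑ x : Rˣ, ψ (u * x + (x⁻¹ : Rˣ))
      = ∑ y : R, ∑ x : Rˣ, ψ (u * x + (x⁻¹ : Rˣ)) := by simp
    _ = ∑ y : R, ∑ x : Rˣ, ψ (u * x + (x⁻¹ : Rˣ)) * ψ (y * (ε * (u * x - (x⁻¹ : Rˣ)))) := by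
      refine Finset.sum_congr rfl fun y _ ↦ ?_
      rw [← Equiv.sum_comp (Equiv.mulRight (unitOneAdd hε y))]
      refine Finset.sum_congr rfl fun x _ ↦ ?_
      rw [← AddChar.map_add_eq_mul]
      congr 1
      simp only [Equiv.coe_mulRight, mul_inv, Units.val_mul]
      change u * (x * (1 + ε * y)) + (x⁻¹ : Rˣ) * (1 - ε * y) = _
      ring
    _ = ∑ x : Rˣ, ψ (u * x + (x⁻¹ : Rˣ)) * ∑ y : R, ψ (y * (ε * (u * x - (x⁻¹ : Rˣ)))) := by
      rw [Finset.sum_comm]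
      simp only [Finset.mul_sum]
    _ = _ := by
      rw [Finset.mul_sum]
      refine Finset.sum_congr rfl fun x _ ↦ ?_
      rw [AddChar.sum_mulShift _ hψ]
      split_ifs <;> simp [mul_comm]

theorem sum_pow_sum_units_eq_zero (hψ : ψ.IsPrimitive) (hε : ε * ε = 0) (n : ℕ)
    (hns : ∀ (u : R) (x : Fin n → Rˣ), (∀ i, ε * (u * x i - ((x i)⁻¹ : Rˣ)) = 0) →
      ε * ∑ i, (x i : R) ≠ 0) :
    ∑ u : R, (∑ x : Rˣ, ψ (u * x + (x⁻¹ : Rˣ))) ^ n = 0 := by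
  have hcard : (Fintype.card R : ℂ) ≠ 0 := by simp
  refine (mul_eq_zero.mp ?_).resolve_left hcard
  set K : R → ℂ := fun u ↦ ∑ x : Rˣ, ψ (u * x + (x⁻¹ : Rˣ)) with hK
  have hshift : ∀ u v : R, K (u + ε * v) ^ n = ∑ x : Fin n → Rˣ,
      (∏ i, if ε * (u * x i - ((x i)⁻¹ : Rˣ)) = 0 then ψ (u * x i + ((x i)⁻¹ : Rˣ)) else 0) *
        ψ (v * (ε * ∑ i, (x i : R))) := by
    intro u v
    rw [hK]
    dsimp only
    rw [sum_units_eq_sum_ite hψ hε, Fintype.sum_pow]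
    refine Finset.sum_congr rfl fun x _ ↦ ?_
    have : ψ (v * (ε * ∑ i, (x i : R))) = ∏ i, ψ (v * (ε * x i)) := by
      rw [Finset.mul_sum, Finset.mul_sum, AddChar.map_sum_eq_prod]
    rw [this, ← Finset.prod_mul_distrib]
    refine Finset.prod_congr rfl fun i _ ↦ ?_
    have hcond : ε * ((u + ε * v) * x i - ((x i)⁻¹ : Rˣ)) =
        ε * (u * x i - ((x i)⁻¹ : Rˣ)) := by
      linear_combination (v * x i) * hε
    rw [hcond, ite_mul, zero_mul, ← AddChar.map_add_eq_mul]
    congr 2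
    ring
  calc (Fintype.card R : ℂ) * ∑ u, K u ^ n = ∑ v : R, ∑ u, K u ^ n := by simp
    _ = ∑ v : R, ∑ u, K (u + ε * v) ^ n := by
      refine Finset.sum_congr rfl fun v _ ↦ ?_
      exact (Equiv.sum_comp (Equiv.addRight (ε * v)) fun u ↦ K u ^ n).symm
    _ = ∑ u : R, ∑ v : R, K (u + ε * v) ^ n := Finset.sum_comm
    _ = 0 := by
      refine Finset.sum_eq_zero fun u _ ↦ ?_
      simp only [hshift]
      rw [Finset.sum_comm]
      refine Finset.sum_eq_zero fun x _ ↦ ?_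
      rw [← Finset.mul_sum, AddChar.sum_mulShift _ hψ]
      by_cases hx : ∀ i, ε * (u * x i - ((x i)⁻¹ : Rˣ)) = 0
      · simp [hns u x hx]
      · push Not at hx
        obtain ⟨i, hi⟩ := hx
        rw [Finset.prod_eq_zero (Finset.mem_univ i) (if_neg hi), zero_mul]

/-- The left-hand side minus one of the equation counted by `V`. -/
def reciprocalDefect {R : Type*} [CommRing R] {ι : Type*} [Fintype ι] (x : ι → Rˣ) : R :=
  (∑ i, (x i : R)) * (∑ i, (((x i)⁻¹ : Rˣ) : R)) - 1

theorem reciprocalDefect_mul_unitOneAdd {R : Type*} [CommRing R] {ε : R} {ι : Type*} [Fintype ι]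
    (hε : ε * ε = 0) (x : ι → Rˣ) (y : ι → R) :
    reciprocalDefect (fun i ↦ x i * unitOneAdd hε (y i)) = reciprocalDefect x +
      ε * ∑ i, y i * ((∑ j, (((x j)⁻¹ : Rˣ) : R)) * x i -
        (∑ j, (x j : R)) * (((x i)⁻¹ : Rˣ) : R)) := by
  have h1 : ∑ i, ((x i * unitOneAdd hε (y i) : Rˣ) : R) =
      ∑ i, (x i : R) + ε * ∑ i, y i * x i := by
    rw [Finset.mul_sum, ← Finset.sum_add_distrib]
    refine Finset.sum_congr rfl fun i _ ↦ ?_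
    change (x i : R) * (1 + ε * y i) = _
    ring
  have h2 : ∑ i, (((x i * unitOneAdd hε (y i))⁻¹ : Rˣ) : R) =
      ∑ i, (((x i)⁻¹ : Rˣ) : R) - ε * ∑ i, y i * (((x i)⁻¹ : Rˣ) : R) := by
    rw [Finset.mul_sum, ← Finset.sum_sub_distrib]
    refine Finset.sum_congr rfl fun i _ ↦ ?_
    rw [mul_inv, Units.val_mul]
    change (((x i)⁻¹ : Rˣ) : R) * (1 - ε * y i) = _
    ring
  have h3 : ∑ i, y i * ((∑ j, (((x j)⁻¹ : Rˣ) : R)) * x i -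
        (∑ j, (x j : R)) * (((x i)⁻¹ : Rˣ) : R)) =
      (∑ j, (((x j)⁻¹ : Rˣ) : R)) * ∑ i, y i * x i -
        (∑ j, (x j : R)) * ∑ i, y i * (((x i)⁻¹ : Rˣ) : R) := by
    rw [Finset.mul_sum, Finset.mul_sum, ← Finset.sum_sub_distrib]
    exact Finset.sum_congr rfl fun i _ ↦ by ring
  unfold reciprocalDefect
  rw [h1, h2, h3]
  linear_combination (-(∑ i, y i * (x i : R)) * ∑ i, y i * (((x i)⁻¹ : Rˣ) : R)) * hε

theorem card_mul_card_reciprocalDefect_eq_zero {ι : Type*} [Fintype ι] [DecidableEq ι]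
    (hψ : ψ.IsPrimitive) (hε : ε * ε = 0)
    (hns : ∀ (x : ι → Rˣ) (v : R), ε ∣ reciprocalDefect x → ε * v ≠ 0 →
      ∃ i, v * ε * ((∑ j, (((x j)⁻¹ : Rˣ) : R)) * x i -
        (∑ j, (x j : R)) * (((x i)⁻¹ : Rˣ) : R)) ≠ 0) :
    Nat.card R * Nat.card {x : ι → Rˣ // reciprocalDefect x = 0} =
      Nat.card {v : R // ε * v = 0} * Nat.card {x : ι → Rˣ // ε ∣ reciprocalDefect x} := by
  classical
  have hinner : ∀ v : R, (∑ x : ι → Rˣ with ε ∣ reciprocalDefect x,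
      ψ (v * reciprocalDefect x)) =
        if ε * v = 0 then (#{x : ι → Rˣ | ε ∣ reciprocalDefect x} : ℂ) else 0 := by
    intro v
    split_ifs with hv
    · rw [Finset.sum_congr rfl (g := fun _ ↦ (1 : ℂ))]
      · simp
      · intro x hx
        obtain ⟨c, hc⟩ := (Finset.mem_filter.mp hx).2
        rw [hc, show v * (ε * c) = ε * v * c by ring, hv, zero_mul, AddChar.map_zero_eq_one]
    · have hcard : (Fintype.card (ι → R) : ℂ) ≠ 0 := by simp
      refine (mul_eq_zero.mp ?_).resolve_left hcard
      rw [Finset.sum_filter]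
      set g : (ι → Rˣ) → ι → R := fun x i ↦ v * ε * ((∑ j, (((x j)⁻¹ : Rˣ) : R)) * x i -
        (∑ j, (x j : R)) * (((x i)⁻¹ : Rˣ) : R)) with hg
      calc (Fintype.card (ι → R) : ℂ) * ∑ x : ι → Rˣ,
            (if ε ∣ reciprocalDefect x then ψ (v * reciprocalDefect x) else 0)
          = ∑ y : ι → R, ∑ x : ι → Rˣ,
            (if ε ∣ reciprocalDefect x then ψ (v * reciprocalDefect x) else 0) := by
              rw [Finset.sum_const, Finset.card_univ, nsmul_eq_mul]
        _ = ∑ y : ι → R, ∑ x : ι → Rˣ,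
            (if ε ∣ reciprocalDefect x then ψ (v * reciprocalDefect x) else 0) *
              ∏ i, ψ (y i * g x i) := by
          refine Finset.sum_congr rfl fun y _ ↦ ?_
          rw [← Equiv.sum_comp (Equiv.mulRight fun i ↦ unitOneAdd hε (y i))]
          refine Finset.sum_congr rfl fun x _ ↦ ?_
          have hmul : reciprocalDefect
              (Equiv.mulRight (fun i ↦ unitOneAdd hε (y i)) x) = _ :=
            reciprocalDefect_mul_unitOneAdd hε x y
          rw [hmul, ite_mul, zero_mul, ← AddChar.map_sum_eq_prod, ← AddChar.map_add_eq_mul]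
          refine if_congr (dvd_add_left (dvd_mul_right _ _)) (congrArg ψ ?_) rfl
          rw [mul_add, hg, Finset.mul_sum, Finset.mul_sum]
          congr 1
          exact Finset.sum_congr rfl fun i _ ↦ by ring
        _ = ∑ x : ι → Rˣ,
            (if ε ∣ reciprocalDefect x then ψ (v * reciprocalDefect x) else 0) *
              ∏ i, ∑ t : R, ψ (t * g x i) := by
          rw [Finset.sum_comm]
          refine Finset.sum_congr rfl fun x _ ↦ ?_
          rw [Fintype.prod_sum, Finset.mul_sum]
        _ = 0 := by
          refine Finset.sum_eq_zero fun x _ ↦ ?_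
          by_cases hx : ε ∣ reciprocalDefect x
          · obtain ⟨i, hi⟩ := hns x v hx hv
            refine mul_eq_zero_of_right _ (Finset.prod_eq_zero (Finset.mem_univ i) ?_)
            rw [AddChar.sum_mulShift _ hψ, if_neg hi, Nat.cast_zero]
          · rw [if_neg hx, zero_mul]
  have hsub : #{x : ι → Rˣ | reciprocalDefect x = 0} =
      #{x ∈ ({x | ε ∣ reciprocalDefect x} : Finset (ι → Rˣ)) | reciprocalDefect x = 0} := by
    rw [Finset.filter_filter]
    congr 1
    ext x
    simp only [Finset.mem_filter, Finset.mem_univ, true_and]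
    exact ⟨fun h ↦ ⟨h ▸ dvd_zero _, h⟩, And.right⟩
  have key := calc
    ((Fintype.card R * #{x : ι → Rˣ | reciprocalDefect x = 0} : ℕ) : ℂ)
      = ∑ x : ι → Rˣ with ε ∣ reciprocalDefect x, ∑ v : R, ψ (v * reciprocalDefect x) := by
        simp only [AddChar.sum_mulShift _ hψ]
        rw [← Nat.cast_sum, ← Finset.sum_filter, Finset.sum_const, smul_eq_mul, hsub, mul_comm]
    _ = ∑ v : R, ∑ x : ι → Rˣ with ε ∣ reciprocalDefect x, ψ (v * reciprocalDefect x) :=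
        Finset.sum_comm
    _ = ((#{v : R | ε * v = 0} * #{x : ι → Rˣ | ε ∣ reciprocalDefect x} : ℕ) : ℂ) := by
        simp only [hinner]
        rw [← Finset.sum_filter, Finset.sum_const, nsmul_eq_mul, Nat.cast_mul]
  simp only [Nat.card_eq_fintype_card, Fintype.card_subtype]
  exact_mod_cast key

end FiniteRing

section PrimePower

theorem primePow_mul_self {p k : ℕ} (hk : 1 ≤ k) : (p ^ k : ZMod (p ^ (k + 1))) * p ^ k = 0 := by
  rw [← pow_add]
  exact_mod_cast (ZMod.natCast_eq_zero_iff _ _).mpr (pow_dvd_pow p (by lia : k + 1 ≤ k + k))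

variable {p k : ℕ} [Fact p.Prime]

theorem primePow_mul_eq_zero_iff (a : ZMod (p ^ (k + 1))) :
    (p ^ k : ZMod (p ^ (k + 1))) * a = 0 ↔
      ZMod.castHom (dvd_pow_self p k.add_one_ne_zero) (ZMod p) a = 0 := by
  obtain ⟨a, rfl⟩ := ZMod.natCast_zmod_surjective a
  rw [map_natCast, ZMod.natCast_eq_zero_iff, ← Nat.cast_pow, ← Nat.cast_mul,
    ZMod.natCast_eq_zero_iff, pow_succ]
  exact Nat.mul_dvd_mul_iff_left (pow_pos (Fact.out : p.Prime).pos k)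

theorem primePow_dvd_iff (a : ZMod (p ^ (k + 1))) :
    (p ^ k : ZMod (p ^ (k + 1))) ∣ a ↔
      ZMod.castHom (pow_dvd_pow p (k.le_add_right 1)) (ZMod (p ^ k)) a = 0 := by
  constructor
  · rintro ⟨c, rfl⟩
    rw [map_mul, map_pow, map_natCast]
    have : (p ^ k : ZMod (p ^ k)) = 0 := by exact_mod_cast ZMod.natCast_self (p ^ k)
    rw [this, zero_mul]
  · obtain ⟨a, rfl⟩ := ZMod.natCast_zmod_surjective a
    rw [map_natCast, ZMod.natCast_eq_zero_iff]
    exact fun h ↦ by exact_mod_cast Nat.cast_dvd_cast (α := ZMod (p ^ (k + 1))) h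

theorem Kl_eq_sum_units (q : ℕ) [NeZero q] (u : ℤ) :
    Kl q u 1 = ∑ x : (ZMod q)ˣ,
      ZMod.stdAddChar (N := q) ((u : ZMod q) * x + (x⁻¹ : (ZMod q)ˣ)) := by
  have hterm : ∀ x : ℕ, Complex.exp (2 * Real.pi * Complex.I *
      ((u : ℂ) * (x : ℂ) + ((1 : ℤ) : ℂ) * ((((x : ZMod q)⁻¹ : ZMod q).val : ℕ) : ℂ)) / (q : ℂ)) =
      ZMod.stdAddChar (N := q) ((u : ZMod q) * x + (x : ZMod q)⁻¹) := fun x ↦ by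
    have := ZMod.stdAddChar_coe (N := q) (u * x + ((x : ZMod q)⁻¹ : ZMod q).val)
    push_cast at this
    rw [ZMod.natCast_zmod_val] at this
    rw [this]
    push_cast
    rw [one_mul]
  unfold Kl
  simp only [hterm]
  rw [← Finset.sum_filter]
  symm
  refine Finset.sum_bij (fun x _ ↦ (x : ZMod q).val) ?_ ?_ ?_ ?_
  · intro x _
    exact Finset.mem_filter.mpr
      ⟨Finset.mem_range.mpr (ZMod.val_lt _), ZMod.val_coe_unit_coprime x⟩
  · intro x _ y _ h
    exact Units.ext (ZMod.val_injective q h)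
  · intro b hb
    obtain ⟨hb, hcop⟩ := Finset.mem_filter.mp hb
    exact ⟨ZMod.unitOfCoprime b hcop, Finset.mem_univ _, by
      rw [ZMod.coe_unitOfCoprime, ZMod.val_cast_of_lt (Finset.mem_range.mp hb)]⟩
  · intro x _
    rw [ZMod.natCast_zmod_val, ZMod.inv_coe_unit]

theorem S_eq_sum_zmod (n q : ℕ) [NeZero q] :
    S n q = ∑ u : ZMod q,
      (∑ x : (ZMod q)ˣ, ZMod.stdAddChar (N := q) (u * x + (x⁻¹ : (ZMod q)ˣ))) ^ n := by
  unfold S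
  simp only [Kl_eq_sum_units]
  rw [← Equiv.sum_comp (Equiv.addRight (1 : ZMod q))]
  symm
  refine Finset.sum_bij (fun u _ ↦ u.val) ?_ ?_ ?_ ?_
  · exact fun u _ ↦ Finset.mem_range.mpr (ZMod.val_lt u)
  · exact fun u _ v _ h ↦ ZMod.val_injective q h
  · exact fun b hb ↦ ⟨b, Finset.mem_univ _, ZMod.val_cast_of_lt (Finset.mem_range.mp hb)⟩
  · intro u _
    simp

theorem V_eq_card_reciprocalDefect (n q : ℕ) :
    V n q = Nat.card {x : Fin (n - 1) → (ZMod q)ˣ // reciprocalDefect x = 0} := by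
  simp only [V, reciprocalDefect, sub_eq_zero]

theorem map_reciprocalDefect {R R' ι : Type*} [CommRing R] [CommRing R'] [Fintype ι]
    (f : R →+* R') (x : ι → Rˣ) :
    f (reciprocalDefect x) = reciprocalDefect fun i ↦ Units.map (f : R →* R') (x i) := by
  simp [reciprocalDefect, map_sum]

theorem S_primePow_eq_zero {n : ℕ} (hodd : Odd n) (hcase : n < p ∨ p = 2) (hk : 1 ≤ k) :
    S n (p ^ (k + 1)) = 0 := by
  rw [S_eq_sum_zmod]
  refine sum_pow_sum_units_eq_zero (ZMod.isPrimitive_stdAddChar _)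
    (ε := (p ^ k : ZMod (p ^ (k + 1)))) (primePow_mul_self hk) n fun u x hx ↦ ?_
  simp only [primePow_mul_eq_zero_iff, map_sub, map_mul, ne_eq, map_sum] at hx ⊢
  set ρ := ZMod.castHom (dvd_pow_self p k.add_one_ne_zero) (ZMod p)
  have hunit : ∀ i, ρ (x i) * ρ ((x i)⁻¹ : (ZMod (p ^ (k + 1)))ˣ) = 1 := fun i ↦ by
    rw [← map_mul, Units.mul_inv, map_one]
  have hsq : ∀ i, ρ u * ρ (x i) ^ 2 = 1 := fun i ↦ by
    linear_combination ρ (x i) * hx i + hunit i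
  have i₀ : Fin n := ⟨0, hodd.pos⟩
  have hu : ρ u ≠ 0 := left_ne_zero_of_mul_eq_one (hsq i₀)
  refine sum_ne_zero_of_sq_eq_sq (by simpa using hodd) (by simpa using hcase) _
    (left_ne_zero_of_mul_eq_one (hunit i₀)) fun i ↦ ?_
  exact mul_left_cancel₀ hu ((hsq i).trans (hsq i₀).symm)

theorem exists_reciprocalDefect_gradient_ne_zero {ι : Type*} [Fintype ι]
    (hodd : Odd (Fintype.card ι + 1)) (hcase : Fintype.card ι + 1 < p ∨ p = 2)
    (x : ι → (ZMod p)ˣ) (hx : reciprocalDefect x = 0) :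
    ∃ i, (∑ j, (((x j)⁻¹ : (ZMod p)ˣ) : ZMod p)) * x i -
      (∑ j, (x j : ZMod p)) * (((x i)⁻¹ : (ZMod p)ˣ) : ZMod p) ≠ 0 := by
  by_contra! h
  set A := ∑ j, (x j : ZMod p)
  set B := ∑ j, (((x j)⁻¹ : (ZMod p)ˣ) : ZMod p)
  have hAB : A * B = 1 := sub_eq_zero.mp hx
  have hsq : ∀ i, (x i : ZMod p) ^ 2 = A ^ 2 := fun i ↦ by
    linear_combination (A * x i) * h i - (x i : ZMod p) ^ 2 * hAB + A ^ 2 * (x i).mul_inv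
  refine sum_ne_zero_of_sq_eq_sq (ι := Option ι) (by simpa using hodd) (by simpa using hcase)
    (fun o ↦ o.elim (-A) fun i ↦ (x i : ZMod p)) (left_ne_zero_of_mul_eq_one hAB) ?_ ?_
  · rintro (_ | i)
    · simp
    · exact hsq i
  · simp [Fintype.sum_option, A]

theorem V_primePow_succ {n : ℕ} (hn : 3 ≤ n) (hodd : Odd n) (hcase : n < p ∨ p = 2)
    (hk : 1 ≤ k) : V n (p ^ (k + 1)) = p ^ (n - 2) * V n (p ^ k) := by
  have hp : p.Prime := Fact.out
  have hcount := card_mul_card_reciprocalDefect_eq_zero (ι := Fin (n - 1))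
    (ZMod.isPrimitive_stdAddChar (p ^ (k + 1))) (ε := (p ^ k : ZMod (p ^ (k + 1))))
    (primePow_mul_self hk) (by
      intro x v hx hv
      set ρ := ZMod.castHom (dvd_pow_self p k.add_one_ne_zero) (ZMod p) with hρ
      have hρx : ρ (reciprocalDefect x) = 0 := by
        obtain ⟨c, hc⟩ := hx
        rw [hc, map_mul, map_pow, map_natCast, ZMod.natCast_self,
          zero_pow (Nat.one_le_iff_ne_zero.mp hk), zero_mul]
      have hcard : Fintype.card (Fin (n - 1)) + 1 = n := by simp; lia
      obtain ⟨i, hi⟩ := exists_reciprocalDefect_gradient_ne_zero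
        (by rwa [hcard]) (by rwa [hcard]) _ ((map_reciprocalDefect ρ x).symm.trans hρx)
      refine ⟨i, ?_⟩
      rw [mul_comm v, mul_assoc, ne_eq, primePow_mul_eq_zero_iff, map_mul, mul_eq_zero, not_or]
      refine ⟨fun h ↦ hv ((primePow_mul_eq_zero_iff v).mpr h), ?_⟩
      simp only [map_sub, map_mul, map_sum]
      exact hi)
  have hker := (ZMod.castHom (dvd_pow_self p k.add_one_ne_zero) (ZMod p)).toAddMonoidHom
    |>.card_subtype_comp_add_card
      (ZMod.castHom_surjective (dvd_pow_self p k.add_one_ne_zero)) (· = 0)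
  have hlift := ((ZMod.unitsMap (pow_dvd_pow p (k.le_add_right 1))).compLeft (Fin (n - 1)))
    |>.card_subtype_comp_mul_card
      (ZMod.unitsMap_surjective (pow_dvd_pow p (k.le_add_right 1))).comp_left
      (fun x ↦ reciprocalDefect x = 0)
  have hlift_iff : ∀ x : Fin (n - 1) → (ZMod (p ^ (k + 1)))ˣ,
      reciprocalDefect ((ZMod.unitsMap (pow_dvd_pow p (k.le_add_right 1))).compLeft (Fin (n - 1)) x) =
          0 ↔
        (p ^ k : ZMod (p ^ (k + 1))) ∣ reciprocalDefect x := fun x ↦ by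
    rw [primePow_dvd_iff, map_reciprocalDefect]
    rfl
  have hker_iff : ∀ v : ZMod (p ^ (k + 1)),
      (ZMod.castHom (dvd_pow_self p k.add_one_ne_zero) (ZMod p)).toAddMonoidHom v = 0 ↔
        (p ^ k : ZMod (p ^ (k + 1))) * v = 0 := fun v ↦ (primePow_mul_eq_zero_iff v).symm
  simp only [hlift_iff, hker_iff, Nat.card_fun, Nat.card_eq_fintype_card (α := (ZMod _)ˣ),
    ZMod.card_units_eq_totient, Nat.card_zmod, Nat.card_fin, Nat.card_unique, mul_one]
    at hlift hker hcount
  rw [← V_eq_card_reciprocalDefect] at hlift hcount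
  rw [pow_succ] at hker
  have hker' : Nat.card {v : ZMod (p ^ (k + 1)) // (p ^ k : ZMod (p ^ (k + 1))) * v = 0} =
      p ^ k :=
    Nat.mul_right_cancel hp.pos hker
  rw [hker'] at hcount
  have htot : Nat.totient (p ^ (k + 1)) = p * Nat.totient (p ^ k) := by
    obtain ⟨j, rfl⟩ := Nat.exists_eq_add_of_le' hk
    rw [Nat.totient_prime_pow_succ hp, Nat.totient_prime_pow_succ hp]
    ring
  rw [htot, mul_pow] at hlift
  have hpos : 0 < Nat.totient (p ^ k) ^ (n - 1) :=
    pow_pos (Nat.totient_pos.mpr (pow_pos hp.pos k)) _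
  have hY : Nat.card {x : Fin (n - 1) → (ZMod (p ^ (k + 1)))ˣ //
      (p ^ k : ZMod (p ^ (k + 1))) ∣ reciprocalDefect x} = p ^ (n - 1) * V n (p ^ k) :=
    Nat.mul_right_cancel hpos (hlift.trans (by ring))
  rw [hY, show n - 1 = n - 2 + 1 by lia] at hcount
  refine Nat.mul_left_cancel (pow_pos hp.pos (k + 1)) (hcount.trans ?_)
  ring

end PrimePower

/-- Let `n ≥ 3` be odd and `p` a prime with `p > n` or `p = 2`. Then for every `r ≥ 2`,
`V_n(p^r) = p^(n−2)·V_n(p^(r−1))` and `S_n(p^r) = 0`. -/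
theorem odd_moment_special_case (n p r : ℕ) (hn : 3 ≤ n) (hodd : Odd n)
    (hp : p.Prime) (hcase : n < p ∨ p = 2) (hr : 2 ≤ r) :
    V n (p ^ r) = p ^ (n - 2) * V n (p ^ (r - 1)) ∧ S n (p ^ r) = 0 := by
  have : Fact p.Prime := ⟨hp⟩
  obtain ⟨k, rfl⟩ := Nat.exists_eq_add_of_le' (one_le_two.trans hr)
  have hk : 1 ≤ k := by lia
  exact ⟨V_primePow_succ hn hodd hcase hk, S_primePow_eq_zero hodd hcase hk⟩
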